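/- Let A be a (not necessarily commutative) ring. If the Laurent series ring R = A((x)) is a right serial ring, then both R and A are right Noetherian rings. -/

import Mathlib

/-- A module is *uniserial* if any two of its submodules are comparable with
respect to inclusion. -/
def IsUniserialModule (R M : Type*) [Ring R] [AddCommGroup M] [Module R M] : Prop :=
  ∀ N₁ N₂ : Submodule R M, N₁ ≤ N₂ ∨ N₂ ≤ N₁

/-- A ring `A` is *right serial* if `A` is a finite direct sum of uniserial right
ideals, i.e. the right module `A_A` is a serial module.  Right ideals of `A` are
the submodules of `A` viewed as a right module over itself, i.e. as a module
over the opposite ring `Aᵐᵒᵖ`. -/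
def IsRightSerialRing (A : Type*) [Ring A] : Prop :=
  ∃ (ι : Type) (_ : Fintype ι) (N : ι → Submodule Aᵐᵒᵖ A),
    iSupIndep N ∧ (⨆ i, N i) = ⊤ ∧ ∀ i, IsUniserialModule Aᵐᵒᵖ (N i)

/-- A ring `A` is *left serial* if `A` is a finite direct sum of uniserial left
ideals, i.e. the left module `_AA` is a serial module. -/
def IsLeftSerialRing (A : Type*) [Ring A] : Prop :=
  ∃ (ι : Type) (_ : Fintype ι) (N : ι → Submodule A A),
    iSupIndep N ∧ (⨆ i, N i) = ⊤ ∧ ∀ i, IsUniserialModule A (N i)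

/-- A module `M` is *finite-dimensional* if it contains no infinite direct sum of
nonzero submodules, i.e. there is no infinite independent family of nonzero
submodules of `M`. -/
def IsFinDimModule (R M : Type*) [Ring R] [AddCommGroup M] [Module R M] : Prop :=
  ¬ ∃ (ι : Type) (_ : Infinite ι) (N : ι → Submodule R M),
      (∀ i, N i ≠ ⊥) ∧ iSupIndep N

/-- A module `M` is *quotient finite-dimensional* if every factor module of `M`
is finite-dimensional. -/
def IsQFDModule (R M : Type*) [Ring R] [AddCommGroup M] [Module R M] : Prop :=
  ∀ N : Submodule R M, IsFinDimModule R (M ⧸ N)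

/-! ### Redundancy of large families in serial modules -/

theorem IsUniserialModule.mem_span_singleton_or {R M : Type*} [Ring R] [AddCommGroup M]
    [Module R M] {U : Submodule R M} (hU : IsUniserialModule R U) {x y : M} (hx : x ∈ U)
    (hy : y ∈ U) : x ∈ Submodule.span R {y} ∨ y ∈ Submodule.span R {x} := by
  refine (hU (Submodule.span R {⟨x, hx⟩}) (Submodule.span R {⟨y, hy⟩})).imp ?_ ?_ <;>
  · rw [Submodule.span_singleton_le_iff_mem, Submodule.mem_span_singleton,
      Submodule.mem_span_singleton]
    rintro ⟨a, ha⟩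
    exact ⟨a, congrArg Subtype.val ha⟩

/-- Among more than `n` elements in a sum of `n` uniserial submodules, one lies in the span of the
others. -/
theorem exists_mem_span_of_uniserial {R M ι κ : Type*} [Ring R] [AddCommGroup M] [Module R M]
    (U : ι → Submodule R M) (hU : ∀ i, IsUniserialModule R (U i)) (s : Finset ι) :
    ∀ (T : Finset κ) (v : κ → M), s.card < T.card → (∀ k ∈ T, v k ∈ s.sup U) →
      ∃ k ∈ T, v k ∈ Submodule.span R (v '' {l | l ∈ T ∧ l ≠ k}) := by
  classical
  induction s using Finset.induction_on with
  | empty =>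
    intro T v hT hv
    obtain ⟨k, hk⟩ := Finset.card_pos.1 (by simpa using hT)
    have h0 : v k = 0 := by simpa using hv k hk
    exact ⟨k, hk, h0 ▸ zero_mem _⟩
  | insert i s hi ih =>
    intro T v hT hv
    rw [Finset.card_insert_of_notMem hi] at hT
    have hdec : ∀ k, ∃ u w, k ∈ T → u ∈ U i ∧ w ∈ s.sup U ∧ u + w = v k := by
      intro k
      by_cases hk : k ∈ T
      · have := hv k hk
        rw [Finset.sup_insert, Submodule.mem_sup] at this
        obtain ⟨u, hu, w, hw, h⟩ := this
        exact ⟨u, w, fun _ => ⟨hu, hw, h⟩⟩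
      · exact ⟨0, 0, fun h => absurd h hk⟩
    choose u w huw using hdec
    obtain ⟨b, hbT, hb⟩ := T.exists_maximalFor (fun k => Submodule.span R {u k})
      (Finset.card_pos.1 (by omega))
    have hr : ∀ k, ∃ r : R, k ∈ T → r • u b = u k := by
      intro k
      by_cases hk : k ∈ T
      · have : u k ∈ Submodule.span R {u b} := by
          rcases (hU i).mem_span_singleton_or (huw k hk).1 (huw b hbT).1 with h | h
          · exact h
          · have := hb hk ((Submodule.span_singleton_le_iff_mem _ _).2 h)
            exact (Submodule.span_singleton_le_iff_mem _ _).1 this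
        obtain ⟨r, hr⟩ := Submodule.mem_span_singleton.1 this
        exact ⟨r, fun _ => hr⟩
      · exact ⟨0, fun h => absurd h hk⟩
    choose r hr using hr
    obtain ⟨k, hk, hmem⟩ := ih (T.erase b) (fun k => v k - r k • v b)
      (by rw [Finset.card_erase_of_mem hbT]; omega) (by
        intro k hk
        have hkT := Finset.mem_of_mem_erase hk
        have : v k - r k • v b = w k - r k • w b := by
          rw [← (huw k hkT).2.2, ← (huw b hbT).2.2, smul_add, hr k hkT]
          abel
        simp only [this]
        exact sub_mem (huw k hkT).2.1 (Submodule.smul_mem _ _ (huw b hbT).2.1))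
    have hkT := Finset.mem_of_mem_erase hk
    have hbk : v b ∈ Submodule.span R (v '' {l | l ∈ T ∧ l ≠ k}) :=
      Submodule.subset_span ⟨b, ⟨hbT, (Finset.ne_of_mem_erase hk).symm⟩, rfl⟩
    refine ⟨k, hkT, ?_⟩
    have hle : Submodule.span R ((fun k => v k - r k • v b) '' {l | l ∈ T.erase b ∧ l ≠ k}) ≤
        Submodule.span R (v '' {l | l ∈ T ∧ l ≠ k}) := by
      rw [Submodule.span_le]
      rintro _ ⟨l, ⟨hl, hlk⟩, rfl⟩
      exact sub_mem (Submodule.subset_span ⟨l, ⟨Finset.mem_of_mem_erase hl, hlk⟩, rfl⟩)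
        (Submodule.smul_mem _ _ hbk)
    have := add_mem (hle hmem) (Submodule.smul_mem _ (r k) hbk)
    simpa using this

theorem IsRightSerialRing.exists_mem_span {R : Type*} [Ring R] (h : IsRightSerialRing R)
    (v : ℕ → R) : ∃ k, v k ∈ Submodule.span Rᵐᵒᵖ (v '' {l | l ≠ k}) := by
  obtain ⟨ι, _, N, -, htop, hN⟩ := h
  obtain ⟨k, -, hk⟩ := exists_mem_span_of_uniserial N hN Finset.univ
    (Finset.range (Fintype.card ι + 1)) v (by simp) (fun k _ => by
      rw [Finset.sup_univ_eq_iSup, htop]; trivial)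
  exact ⟨k, Submodule.span_mono (Set.image_mono fun l hl => hl.2) hk⟩

/-! ### Coefficients of Laurent series -/

namespace LaurentSeries

variable {A : Type*} [Ring A]

theorem coeff_mul_mem {S : Type*} [SetLike S A] [AddSubmonoidClass S A] (B : S)
    {f g : LaurentSeries A} {z : ℤ} (h : ∀ i j, i + j = z → f.coeff i * g.coeff j ∈ B) :
    (f * g).coeff z ∈ B := by
  rw [HahnSeries.coeff_mul]
  refine sum_mem fun ij hij => h _ _ ?_
  simpa using (Finset.mem_antidiagonal.1 hij).2.2

/-- The Laurent series `∑ n, c n * x ^ n`. -/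
def ofSeq (c : ℕ → A) : LaurentSeries A :=
  HahnSeries.ofSuppBddBelow (fun z : ℤ => if 0 ≤ z then c z.toNat else 0)
    ⟨0, fun z hz => by by_contra hlt; simp [hlt] at hz⟩

theorem coeff_ofSeq (c : ℕ → A) (z : ℤ) :
    (ofSeq c).coeff z = if 0 ≤ z then c z.toNat else 0 := rfl

/-! ### Right Noetherian coefficients from serial Laurent series -/

/-- Series whose coefficients up to any fixed distance beyond `m ^ 2` lie in `B m`, for all large
`m` in `S`. -/
def squareTail (B : ℕ → Submodule Aᵐᵒᵖ A) (S : Set ℕ) :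
    Submodule (LaurentSeries A)ᵐᵒᵖ (LaurentSeries A) where
  carrier := {f | ∀ q : ℤ, ∃ M : ℕ, ∀ m ≥ M, m ∈ S → ∀ z ≤ (m : ℤ) ^ 2 + q, f.coeff z ∈ B m}
  zero_mem' q := ⟨0, fun m _ _ z _ => by simp⟩
  add_mem' {f g} hf hg q := by
    obtain ⟨M, hM⟩ := hf q
    obtain ⟨M', hM'⟩ := hg q
    refine ⟨max M M', fun m hm hS z hz => ?_⟩
    rw [HahnSeries.coeff_add]
    exact add_mem (hM m (le_of_max_le_left hm) hS z hz) (hM' m (le_of_max_le_right hm) hS z hz)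
  smul_mem' g f hf q := by
    obtain ⟨M, hM⟩ := hf (q - g.unop.order)
    refine ⟨M, fun m hm hS z hz => coeff_mul_mem _ fun i j hij => ?_⟩
    by_cases hj : j < g.unop.order
    · rw [HahnSeries.coeff_eq_zero_of_lt_order hj, mul_zero]
      exact zero_mem _
    · exact (B m).smul_mem (MulOpposite.op _) (hM m hm hS i (by omega))

/-- The series `∑ m ∈ S, a m * x ^ (m ^ 2)`. -/
noncomputable def squareSeries (a : ℕ → A) (S : Set ℕ) : LaurentSeries A :=
  open Classical in ofSeq fun n => if n.sqrt ^ 2 = n ∧ n.sqrt ∈ S then a n.sqrt else 0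

theorem coeff_squareSeries_sq (a : ℕ → A) {S : Set ℕ} {m : ℕ} (hm : m ∈ S) :
    (squareSeries a S).coeff ((m : ℤ) ^ 2) = a m := by
  have h : ((m : ℤ) ^ 2).toNat = m ^ 2 := by
    rw [← Nat.cast_pow, Int.toNat_natCast]
  rw [squareSeries, coeff_ofSeq, if_pos (by positivity), h, Nat.sqrt_eq', if_pos ⟨rfl, hm⟩]

theorem coeff_squareSeries_mem (a : ℕ → A) {S : Set ℕ} {P : Type*} [SetLike P A]
    [AddSubmonoidClass P A] (B : P) {z : ℤ}
    (h : ∀ m ∈ S, (m : ℤ) ^ 2 = z → a m ∈ B) : (squareSeries a S).coeff z ∈ B := by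
  rw [squareSeries, coeff_ofSeq]
  split_ifs with h0 h1
  · refine h _ h1.2 ?_
    rw [← Nat.cast_pow, h1.1, Int.toNat_of_nonneg h0]
  all_goals exact zero_mem _

theorem squareSeries_mem_squareTail {B : ℕ → Submodule Aᵐᵒᵖ A} (hB : Monotone B) {a : ℕ → A}
    (ha : ∀ m, a m ∈ B (m + 1)) {S T : Set ℕ} (hST : Disjoint S T) :
    squareSeries a S ∈ squareTail B T := by
  refine fun q => ⟨q.toNat, fun m hm hT z hz => coeff_squareSeries_mem a _ fun l hl hlz => ?_⟩
  refine hB (?_ : l < m) (ha l)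
  by_contra! hlm
  rcases hlm.eq_or_lt with rfl | hlt
  · exact Set.disjoint_left.1 hST hl hT
  · have h1 : q ≤ m := Int.toNat_le.1 hm
    have h2 : (m : ℤ) + 1 ≤ l := by exact_mod_cast hlt
    nlinarith

theorem squareSeries_notMem_squareTail {B : ℕ → Submodule Aᵐᵒᵖ A} {a : ℕ → A}
    (ha : ∀ m, a m ∉ B m) {S : Set ℕ} (hS : S.Infinite) :
    squareSeries a S ∉ squareTail B S := by
  intro h
  obtain ⟨M, hM⟩ := h 0
  obtain ⟨m, hm, hlt⟩ := hS.exists_gt M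
  refine ha m ?_
  rw [← coeff_squareSeries_sq a hm]
  exact hM m hlt.le hm _ (by simp)

theorem isNoetherian_coeff_of_rightSerial (h : IsRightSerialRing (LaurentSeries A)) :
    IsNoetherian Aᵐᵒᵖ A := by
  by_contra hA
  rw [isNoetherian_iff, RelEmbedding.wellFounded_iff_isEmpty, not_isEmpty_iff] at hA
  obtain ⟨B⟩ := hA
  have hB : StrictMono B := fun m n hmn => B.map_rel_iff.2 hmn
  choose a ha ha' using fun m => SetLike.exists_of_lt (hB (Nat.lt_succ_self m))
  let S : ℕ → Set ℕ := fun k => {m | m.unpair.1 = k}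
  obtain ⟨k, hk⟩ := h.exists_mem_span fun k => squareSeries a (S k)
  have hS : (S k).Infinite := Set.infinite_of_not_bddAbove fun ⟨M, hM⟩ => by
    have h1 : Nat.pair k (M + 1) ≤ M := hM (by simp [S])
    have h2 := Nat.right_le_pair k (M + 1)
    omega
  refine squareSeries_notMem_squareTail ha' hS (Submodule.span_le.2 ?_ hk)
  rintro _ ⟨l, hl, rfl⟩
  refine squareSeries_mem_squareTail hB.monotone ha (Set.disjoint_left.2 ?_)
  rintro m rfl hm
  exact hl hm

/-! ### Laurent series over a right Noetherian ring -/

/-- The series whose coefficients below `n` vanish. -/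
def vanishBelow (n : ℤ) : AddSubgroup (LaurentSeries A) where
  carrier := {f | ∀ z < n, f.coeff z = 0}
  zero_mem' z _ := by simp
  add_mem' hf hg z hz := by rw [HahnSeries.coeff_add, hf z hz, hg z hz, add_zero]
  neg_mem' hf z hz := by rw [HahnSeries.coeff_neg, hf z hz, neg_zero]

theorem mul_mem_vanishBelow {m n : ℤ} {f g : LaurentSeries A} (hf : f ∈ vanishBelow m)
    (hg : g ∈ vanishBelow n) : f * g ∈ vanishBelow (m + n) := by
  refine fun z hz => AddSubmonoid.mem_bot.1 (coeff_mul_mem ⊥ fun i j hij => ?_)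
  rw [AddSubmonoid.mem_bot]
  rcases lt_or_ge i m with h | h
  · rw [hf i h, zero_mul]
  · rw [hg j (by omega), mul_zero]

theorem single_mem_vanishBelow (n : ℤ) (a : A) :
    (HahnSeries.single n a : LaurentSeries A) ∈ vanishBelow n :=
  fun _ hz => HahnSeries.coeff_single_of_ne hz.ne

theorem ofSeq_sub_sum_mem_vanishBelow (c : ℕ → A) (n : ℕ) :
    ofSeq c - ∑ j ∈ Finset.range n, (HahnSeries.single (j : ℤ) (c j) : LaurentSeries A) ∈
      vanishBelow n := by
  induction n with
  | zero =>
    intro z hz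
    simp only [Finset.range_zero, Finset.sum_empty, sub_zero, coeff_ofSeq]
    exact if_neg (by simpa using hz)
  | succ n ih =>
    intro z hz
    rw [Finset.sum_range_succ, ← sub_sub, HahnSeries.coeff_sub]
    rcases (show z < n ∨ z = n by push_cast at hz; omega) with h | rfl
    · rw [ih z h, HahnSeries.coeff_single_of_ne h.ne, sub_zero]
    · have h0 : (∑ j ∈ Finset.range n,
          (HahnSeries.single (j : ℤ) (c j) : LaurentSeries A)).coeff n = 0 := by
        rw [HahnSeries.coeff_sum]
        refine Finset.sum_eq_zero fun j hj => HahnSeries.coeff_single_of_ne ?_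
        have := Finset.mem_range.1 hj
        omega
      rw [HahnSeries.coeff_sub, h0, HahnSeries.coeff_single_same, coeff_ofSeq]
      simp

/-- The constant coefficients of the power series in a right ideal of Laurent series. -/
def constantCoeffs (I : Submodule (LaurentSeries A)ᵐᵒᵖ (LaurentSeries A)) :
    Submodule Aᵐᵒᵖ A where
  carrier := {a | ∃ f ∈ I, f ∈ vanishBelow 0 ∧ f.coeff 0 = a}
  zero_mem' := ⟨0, zero_mem _, zero_mem _, rfl⟩
  add_mem' := by
    rintro _ _ ⟨f, hf, hf0, rfl⟩ ⟨g, hg, hg0, rfl⟩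
    exact ⟨f + g, add_mem hf hg, add_mem hf0 hg0, rfl⟩
  smul_mem' := by
    rintro c _ ⟨f, hf, hf0, rfl⟩
    exact ⟨f * HahnSeries.single 0 c.unop, I.smul_mem (MulOpposite.op _) hf,
      mul_mem_vanishBelow hf0 (single_mem_vanishBelow 0 _), HahnSeries.coeff_mul_single_zero⟩

theorem constantCoeffs_mono {I J : Submodule (LaurentSeries A)ᵐᵒᵖ (LaurentSeries A)}
    (h : I ≤ J) : constantCoeffs I ≤ constantCoeffs J :=
  fun _ ⟨f, hf, h'⟩ => ⟨f, h hf, h'⟩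

theorem coeff_mem_constantCoeffs {I : Submodule (LaurentSeries A)ᵐᵒᵖ (LaurentSeries A)}
    {f : LaurentSeries A} (hf : f ∈ I) {n : ℤ} (hn : f ∈ vanishBelow n) :
    f.coeff n ∈ constantCoeffs I := by
  refine ⟨f * HahnSeries.single (-n) 1, I.smul_mem (MulOpposite.op _) hf, ?_, ?_⟩
  · have := mul_mem_vanishBelow hn (single_mem_vanishBelow (-n) (1 : A))
    rwa [add_neg_cancel] at this
  · rw [HahnSeries.coeff_mul_single, zero_sub, neg_neg, mul_one]

theorem le_of_constantCoeffs_le {I J : Submodule (LaurentSeries A)ᵐᵒᵖ (LaurentSeries A)}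
    (hfg : (constantCoeffs I).FG) (hIJ : I ≤ J) (h : constantCoeffs J ≤ constantCoeffs I) :
    J ≤ I := by
  obtain ⟨k, a, ha⟩ := Submodule.fg_iff_exists_fin_generating_family.1 hfg
  have hmem : ∀ i, a i ∈ constantCoeffs I := fun i => ha ▸ Submodule.subset_span ⟨i, rfl⟩
  choose F hFI hF0 hFa using hmem
  have step : ∀ (n : ℕ) (f : LaurentSeries A), ∃ c : Fin k → A, f ∈ J → f ∈ vanishBelow n →
      f - ∑ i, F i * HahnSeries.single (n : ℤ) (c i) ∈ vanishBelow ((n + 1 : ℕ) : ℤ) := by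
    intro n f
    by_cases hf : f ∈ J ∧ f ∈ vanishBelow n
    · have hc := h (coeff_mem_constantCoeffs hf.1 hf.2)
      rw [← ha, Submodule.mem_span_range_iff_exists_fun] at hc
      obtain ⟨c, hc⟩ := hc
      refine ⟨fun i => (c i).unop, fun _ _ z hz => ?_⟩
      rw [HahnSeries.coeff_sub, HahnSeries.coeff_sum]
      simp only [HahnSeries.coeff_mul_single]
      rcases (show z < n ∨ z = n by push_cast at hz; omega) with h | rfl
      · rw [hf.2 z h, Finset.sum_eq_zero, sub_zero]
        intro i _
        rw [hF0 i _ (by omega), zero_mul]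
      · rw [← hc, sub_eq_zero]
        refine Finset.sum_congr rfl fun i _ => ?_
        rw [sub_self, hFa]
        rfl
    · exact ⟨0, fun h1 h2 => absurd ⟨h1, h2⟩ hf⟩
  choose c hc using step
  have main : ∀ f ∈ J, f ∈ vanishBelow 0 → f ∈ I := by
    intro f hf hf0
    let r : ℕ → LaurentSeries A := fun n =>
      Nat.rec f (fun n g => g - ∑ i, F i * HahnSeries.single (n : ℤ) (c n g i)) n
    have hr : ∀ n, r (n + 1) = r n - ∑ i, F i * HahnSeries.single (n : ℤ) (c n (r n) i) :=
      fun _ => rfl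
    have hrJ : ∀ n, r n ∈ J := by
      intro n
      induction n with
      | zero => exact hf
      | succ n ih =>
        rw [hr]
        exact sub_mem ih (sum_mem fun i _ => J.smul_mem (MulOpposite.op _) (hIJ (hFI i)))
    have hrn : ∀ n : ℕ, r n ∈ vanishBelow n := by
      intro n
      induction n with
      | zero => exact hf0
      | succ n ih => exact hc n (r n) (hrJ n) ih
    have hrsum : ∀ n, r n = f - ∑ i, F i *
        ∑ j ∈ Finset.range n, HahnSeries.single (j : ℤ) (c j (r j) i) := by
      intro n
      induction n with
      | zero => simp [r]
      | succ n ih =>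
        rw [hr]
        simp only [Finset.sum_range_succ, mul_add, Finset.sum_add_distrib]
        rw [← sub_sub, ← ih]
    have hlim : f = ∑ i, F i * ofSeq fun j => c j (r j) i := by
      rw [← sub_eq_zero]
      have hv : ∀ n : ℕ, f - ∑ i, F i * ofSeq (fun j => c j (r j) i) ∈ vanishBelow (n : ℤ) := by
        intro n
        have e : f - ∑ i, F i * ofSeq (fun j => c j (r j) i) = r n - ∑ i, F i *
            (ofSeq (fun j => c j (r j) i) -
              ∑ j ∈ Finset.range n, HahnSeries.single (j : ℤ) (c j (r j) i)) := by
          rw [hrsum n]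
          simp only [mul_sub, Finset.sum_sub_distrib]
          abel
        rw [e]
        refine sub_mem (hrn n) (sum_mem fun i _ => ?_)
        have := mul_mem_vanishBelow (hF0 i)
          (ofSeq_sub_sum_mem_vanishBelow (fun j => c j (r j) i) n)
        rwa [zero_add] at this
      ext z
      exact hv (z + 1).toNat z (by omega)
    rw [hlim]
    exact sum_mem fun i _ => I.smul_mem (MulOpposite.op _) (hFI i)
  intro f hf
  have hf0 : f ∈ vanishBelow f.order := fun z hz => HahnSeries.coeff_eq_zero_of_lt_order hz
  have h1 := main (f * HahnSeries.single (-f.order) 1) (J.smul_mem (MulOpposite.op _) hf) (by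
    have := mul_mem_vanishBelow hf0 (single_mem_vanishBelow (-f.order) (1 : A))
    rwa [add_neg_cancel] at this)
  have h2 : f * HahnSeries.single (-f.order) 1 * HahnSeries.single f.order 1 ∈ I :=
    I.smul_mem (MulOpposite.op _) h1
  rw [mul_assoc, HahnSeries.single_mul_single, neg_add_cancel, mul_one] at h2
  simpa using h2

theorem isNoetherian_of_isNoetherian_coeff [IsNoetherian Aᵐᵒᵖ A] :
    IsNoetherian (LaurentSeries A)ᵐᵒᵖ (LaurentSeries A) := by
  rw [isNoetherian_iff']
  have hmono : StrictMono (constantCoeffs (A := A)) := fun I J hIJ =>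
    lt_of_le_not_ge (constantCoeffs_mono hIJ.le) fun h =>
      hIJ.not_ge (le_of_constantCoeffs_le (IsNoetherian.noetherian _) hIJ.le h)
  exact hmono.wellFoundedGT

end LaurentSeries

/-- If the Laurent series ring `R = A((x))` is a right serial ring, then both
`R` and `A` are right Noetherian rings. -/
theorem laurentSeries_rightNoetherian_of_rightSerial (A : Type*) [Ring A]
    (h : IsRightSerialRing (LaurentSeries A)) :
    IsNoetherian (LaurentSeries A)ᵐᵒᵖ (LaurentSeries A) ∧ IsNoetherian Aᵐᵒᵖ A := by
  have := LaurentSeries.isNoetherian_coeff_of_rightSerial h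
  exact ⟨LaurentSeries.isNoetherian_of_isNoetherian_coeff, this⟩
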